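/- Let θ : ℝ × ℝ^d → ℝ^d be a continuously differentiable, compactly supported time-dependent velocity field, let T be its flow, and assume T is twice continuously differentiable jointly in (t, X). Let Ω ⊆ ℝ^d be a bounded measurable set, let λ^d denote d-dimensional Lebesgue measure, and let l, β, C₁ ∈ ℝ. Then the map t ↦ l (λ^d(T_t(Ω)) − C₁) + (β/2)(λ^d(T_t(Ω)) − C₁)² is differentiable at t = 0 with derivative [l + β(λ^d(Ω) − C₁)] · ∫_Ω (div θ)(0, x) dx, where (div θ)(0, x) is the trace of the spatial Fréchet derivative of θ(0, ·) at x. -/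

import Mathlib

open MeasureTheory

/-- `Euc d` is the Euclidean space `ℝ^d`. -/
abbrev Euc (d : ℕ) := EuclideanSpace ℝ (Fin d)

section Determinant

variable {E : Type*} [NormedAddCommGroup E] [NormedSpace ℝ E] [FiniteDimensional ℝ E]

theorem contDiff_continuousLinearMap_det {n : WithTop ℕ∞} :
    ContDiff ℝ n (fun A : E →L[ℝ] E => A.det) := by
  classical
  let b := Module.finBasis ℝ E
  have h : (fun A : E →L[ℝ] E => A.det) =
      fun A : E →L[ℝ] E => (LinearMap.toMatrix b b (A : E →ₗ[ℝ] E)).det := by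
    ext A
    exact (LinearMap.det_toMatrix b _).symm
  rw [h]
  simp only [Matrix.det_apply, LinearMap.toMatrix_apply]
  refine ContDiff.sum fun σ _ => ContDiff.const_smul _ (contDiff_prod fun i _ => ?_)
  let L : (E →L[ℝ] E) →ₗ[ℝ] ℝ :=
    (b.coord (σ i)) ∘ₗ (ContinuousLinearMap.apply ℝ E (b i)).toLinearMap
  exact (LinearMap.toContinuousLinearMap L).contDiff

/-- Jacobi's formula at the identity. -/
theorem fderiv_continuousLinearMap_det_id (B : E →L[ℝ] E) :
    fderiv ℝ (fun A : E →L[ℝ] E => A.det) (ContinuousLinearMap.id ℝ E) B =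
      LinearMap.trace ℝ E B.toLinearMap := by
  classical
  let b := Module.finBasis ℝ E
  let M := LinearMap.toMatrix b b B.toLinearMap
  have hline : HasDerivAt (fun r : ℝ => ContinuousLinearMap.id ℝ E + r • B) B 0 := by
    simpa using ((hasDerivAt_id (0 : ℝ)).smul_const B).const_add (ContinuousLinearMap.id ℝ E)
  have hdet : HasFDerivAt (fun A : E →L[ℝ] E => A.det)
      (fderiv ℝ (fun A : E →L[ℝ] E => A.det) (ContinuousLinearMap.id ℝ E))
      (ContinuousLinearMap.id ℝ E + (0 : ℝ) • B) := by
    simpa using ((contDiff_continuousLinearMap_det (E := E) (n := 1)).differentiable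
      one_ne_zero (ContinuousLinearMap.id ℝ E)).hasFDerivAt
  have h₁ := hdet.comp_hasDerivAt (0 : ℝ) hline
  have hpoly : ((fun A : E →L[ℝ] E => A.det) ∘
      fun r : ℝ => ContinuousLinearMap.id ℝ E + r • B) =
      fun r => (Matrix.det (1 + (Polynomial.X : Polynomial ℝ) • M.map Polynomial.C)).eval r := by
    ext r
    have hM : (ContinuousLinearMap.id ℝ E + r • B).det = (1 + r • M).det := by
      rw [ContinuousLinearMap.det, ← LinearMap.det_toMatrix b]
      congr 1
      simp [M]
    rw [Function.comp_apply, hM, ← Polynomial.coe_evalRingHom, RingHom.map_det]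
    congr 1
    ext i j
    by_cases hij : i = j <;> simp [hij, mul_comm r]
  rw [hpoly] at h₁
  have h₂ := (Matrix.det (1 + (Polynomial.X : Polynomial ℝ) • M.map Polynomial.C)).hasDerivAt 0
  rw [Matrix.derivative_det_one_add_X_smul] at h₂
  rw [h₁.unique h₂, LinearMap.trace_eq_matrix_trace ℝ b]

end Determinant

section ParametricIntegral

variable {E : Type*} [NormedAddCommGroup E] [NormedSpace ℝ E] [FiniteDimensional ℝ E]
  [MeasurableSpace E] [BorelSpace E]

theorem hasDerivAt_setIntegral_of_contDiff (μ : Measure E) [IsFiniteMeasureOnCompacts μ]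
    {J : ℝ × E → ℝ} (hJ : ContDiff ℝ 1 J) {Ω : Set E} (hΩb : Bornology.IsBounded Ω)
    (hΩm : MeasurableSet Ω) (t₀ : ℝ) :
    HasDerivAt (fun t => ∫ x in Ω, J (t, x) ∂μ) (∫ x in Ω, fderiv ℝ J (t₀, x) (1, 0) ∂μ) t₀ := by
  have hJ' : Continuous fun p : ℝ × E => fderiv ℝ J p (1, 0) :=
    (hJ.continuous_fderiv one_ne_zero).clm_apply continuous_const
  have hK : IsCompact (closure Ω) := hΩb.isCompact_closure
  obtain ⟨C, hC⟩ := ((isCompact_closedBall t₀ 1).prod hK).exists_bound_of_continuousOn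
    hJ'.continuousOn
  have hΩfin : μ Ω < ⊤ := (measure_mono subset_closure).trans_lt hK.measure_lt_top
  refine (hasDerivAt_integral_of_dominated_loc_of_deriv_le (bound := fun _ => C)
    (F := fun t x => J (t, x)) (F' := fun t x => fderiv ℝ J (t, x) (1, 0))
    (Metric.closedBall_mem_nhds t₀ one_pos) ?_ ?_ ?_ ?_ ?_ ?_).2
  · exact .of_forall fun t => (hJ.continuous.comp (by fun_prop)).aestronglyMeasurable
  · exact ((hJ.continuous.comp (by fun_prop : Continuous fun x : E =>
      (t₀, x))).continuousOn.integrableOn_compact hK).mono_set subset_closure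
  · exact (hJ'.comp (by fun_prop : Continuous fun x : E => (t₀, x))).aestronglyMeasurable
  · filter_upwards [ae_restrict_mem hΩm] with x hx t ht
    exact hC (t, x) ⟨ht, subset_closure hx⟩
  · exact integrableOn_const hΩfin.ne
  · refine .of_forall fun x t _ => ?_
    exact ((hJ.differentiable one_ne_zero (t, x)).hasFDerivAt).comp_hasDerivAt t
      ((hasDerivAt_id t).prodMk (hasDerivAt_const t x))

end ParametricIntegral

section Flow

variable {E : Type*} [NormedAddCommGroup E] [NormedSpace ℝ E]

theorem flow_injective {θ : ℝ × E → E} {K : NNReal} (hθ : LipschitzWith K θ)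
    {T : ℝ → E → E} (hT0 : ∀ X, T 0 X = X)
    (hTflow : ∀ t X, HasDerivAt (fun s => T s X) (θ (t, T t X)) t) (t : ℝ) :
    Function.Injective (T t) := by
  intro X Y h
  have hlip : ∀ s, LipschitzOnWith K (fun x => θ (s, x)) Set.univ := fun s => by
    simpa [Function.comp_def] using
      (hθ.comp (LipschitzWith.prodMk_left s)).lipschitzOnWith (s := Set.univ)
  have := ODE_solution_unique_univ (v := fun s x => θ (s, x)) (s := fun _ => Set.univ)
    (f := fun s => T s X) (g := fun s => T s Y) hlip
    (fun s => ⟨hTflow s X, trivial⟩) (fun s => ⟨hTflow s Y, trivial⟩) h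
  simpa [hT0] using congrFun this 0

theorem hasFDerivAt_slice {f : ℝ × E → E} (hf : Differentiable ℝ f) (t : ℝ) (x : E) :
    HasFDerivAt (fun y => f (t, y))
      ((fderiv ℝ f (t, x)).comp (ContinuousLinearMap.inr ℝ ℝ E)) x :=
  (hf (t, x)).hasFDerivAt.comp x (hasFDerivAt_prodMk_right t x)

/-- For a flow of `θ`, the time derivative at `0` of the spatial derivative is the spatial
derivative of `θ (0, ·)`. -/
theorem fderiv_fderiv_flow {θ : ℝ × E → E} {T : ℝ → E → E} (hT0 : ∀ X, T 0 X = X)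
    (hTflow : ∀ t X, HasDerivAt (fun s => T s X) (θ (t, T t X)) t)
    (hT2 : ContDiff ℝ 2 (fun p : ℝ × E => T p.1 p.2)) (x : E) :
    (fderiv ℝ (fderiv ℝ (fun p : ℝ × E => T p.1 p.2)) (0, x) (1, 0)).comp
      (ContinuousLinearMap.inr ℝ ℝ E) = fderiv ℝ (fun y => θ (0, y)) x := by
  set f : ℝ × E → E := fun p => T p.1 p.2 with hf
  have hf1 : Differentiable ℝ f := hT2.differentiable two_ne_zero
  have hf2 : Differentiable ℝ (fderiv ℝ f) :=
    (hT2.fderiv_right (m := 1) (by norm_num)).differentiable one_ne_zero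
  have hθf : (fun y => θ (0, y)) = fun y => fderiv ℝ f (0, y) (1, 0) := by
    ext y
    have h := (hf1 (0, y)).hasFDerivAt.comp_hasDerivAt (0 : ℝ)
      ((hasDerivAt_id (0 : ℝ)).prodMk (hasDerivAt_const (0 : ℝ) y))
    simpa [hT0] using (hTflow 0 y).unique h
  have hsymm : IsSymmSndFDerivAt ℝ f (0, x) := hT2.contDiffAt.isSymmSndFDerivAt (by simp)
  have hd : HasFDerivAt (fun y => fderiv ℝ f (0, y) (1, 0)) _ x :=
    ((hf2 (0, x)).hasFDerivAt.comp x (hasFDerivAt_prodMk_right 0 x)).clm_apply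
      (hasFDerivAt_const ((1 : ℝ), (0 : E)) x)
  rw [hθf, hd.fderiv]
  ext v
  simpa using hsymm.eq (1, 0) (0, v)

variable [FiniteDimensional ℝ E] [MeasurableSpace E] [BorelSpace E]

/-- The volume transported by a flow has derivative the integral of the divergence. -/
theorem hasDerivAt_measure_image_flow (μ : Measure E) [μ.IsAddHaarMeasure]
    {θ : ℝ × E → E} {K : NNReal} (hθ : LipschitzWith K θ)
    {T : ℝ → E → E} (hT0 : ∀ X, T 0 X = X)
    (hTflow : ∀ t X, HasDerivAt (fun s => T s X) (θ (t, T t X)) t)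
    (hT2 : ContDiff ℝ 2 (fun p : ℝ × E => T p.1 p.2))
    {Ω : Set E} (hΩb : Bornology.IsBounded Ω) (hΩm : MeasurableSet Ω) :
    HasDerivAt (fun t => (μ (T t '' Ω)).toReal)
      (∫ x in Ω, LinearMap.trace ℝ E (fderiv ℝ (fun y => θ (0, y)) x).toLinearMap ∂μ) 0 := by
  set f : ℝ × E → E := fun p => T p.1 p.2 with hf
  have hf1 : Differentiable ℝ f := hT2.differentiable two_ne_zero
  have hf' : ContDiff ℝ 1 (fderiv ℝ f) := hT2.fderiv_right (by norm_num)
  let A : ℝ × E → (E →L[ℝ] E) := fun p => (fderiv ℝ f p).comp (ContinuousLinearMap.inr ℝ ℝ E)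
  have hA : ContDiff ℝ 1 A := hf'.clm_comp contDiff_const
  let J : ℝ × E → ℝ := fun p => (A p).det
  have hJ : ContDiff ℝ 1 J := contDiff_continuousLinearMap_det.comp hA
  have hslice : ∀ t x, HasFDerivAt (T t) (A (t, x)) x := hasFDerivAt_slice hf1
  have hA0 : ∀ x, A (0, x) = ContinuousLinearMap.id ℝ E := fun x => by
    have hT0' : T 0 = id := funext hT0
    exact (hslice 0 x).unique (hT0' ▸ hasFDerivAt_id x)
  have hJ' : ∀ x, fderiv ℝ J (0, x) (1, 0) =
      LinearMap.trace ℝ E (fderiv ℝ (fun y => θ (0, y)) x).toLinearMap := fun x => by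
    have hdA : HasFDerivAt A _ (0, x) :=
      ((hf'.differentiable one_ne_zero (0, x)).hasFDerivAt).clm_comp
        (hasFDerivAt_const (ContinuousLinearMap.inr ℝ ℝ E) ((0 : ℝ), x))
    have hdet := ((contDiff_continuousLinearMap_det (E := E) (n := 1)).differentiable
      one_ne_zero (A (0, x))).hasFDerivAt
    have hdJ : HasFDerivAt J _ (0, x) := hdet.comp (0, x) hdA
    rw [hdJ.fderiv, hA0, ← fderiv_fderiv_flow hT0 hTflow hT2 x,
      ← fderiv_continuousLinearMap_det_id]
    simp [hf]
  have hpos : ∀ᶠ t in nhds (0 : ℝ), ∀ x ∈ closure Ω, 0 < J (t, x) := by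
    refine hΩb.isCompact_closure.eventually_forall_of_forall_eventually fun x _ => ?_
    refine hJ.continuous.continuousAt.eventually (lt_mem_nhds ?_)
    simp [J, hA0, ContinuousLinearMap.det]
  have hvol : (fun t => (μ (T t '' Ω)).toReal) =ᶠ[nhds 0] fun t => ∫ x in Ω, J (t, x) ∂μ := by
    filter_upwards [hpos] with t ht
    have h := integral_image_eq_integral_abs_det_fderiv_smul μ hΩm
      (fun x _ => (hslice t x).hasFDerivWithinAt)
      (flow_injective hθ hT0 hTflow t).injOn (fun _ => (1 : ℝ))
    simp only [setIntegral_const, smul_eq_mul, mul_one] at h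
    refine h.trans (setIntegral_congr_fun hΩm fun x hx => ?_)
    exact abs_of_pos (ht x (subset_closure hx))
  have h := (hasDerivAt_setIntegral_of_contDiff μ hJ hΩb hΩm 0).congr_of_eventuallyEq hvol
  simpa only [hJ'] using h

end Flow

/-- Eulerian derivative of the augmented Lagrangian volume-penalty term
`t ↦ l(λ^d(T_t(Ω)) − C₁) + (β/2)(λ^d(T_t(Ω)) − C₁)²` at `t = 0`, which equals
`[l + β(λ^d(Ω) − C₁)] ∫_Ω (div θ)(0, x) dx`. -/
theorem augmented_lagrangian_volume_penalty_derivative {d : ℕ}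
    (θ : ℝ × Euc d → Euc d)
    (hθ : ContDiff ℝ 1 θ) (hθc : HasCompactSupport θ)
    (T : ℝ → Euc d → Euc d)
    (hT0 : ∀ X, T 0 X = X)
    (hTflow : ∀ t X, HasDerivAt (fun s => T s X) (θ (t, T t X)) t)
    (hT2 : ContDiff ℝ 2 (fun p : ℝ × Euc d => T p.1 p.2))
    (Ω : Set (Euc d)) (hΩb : Bornology.IsBounded Ω) (hΩm : MeasurableSet Ω)
    (l β C₁ : ℝ) :
    HasDerivAt (fun t =>
        l * ((volume (T t '' Ω)).toReal - C₁)
          + β / 2 * ((volume (T t '' Ω)).toReal - C₁) ^ 2)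
      ((l + β * ((volume Ω).toReal - C₁)) *
        ∫ x in Ω, LinearMap.trace ℝ (Euc d) ((fderiv ℝ (fun y => θ (0, y)) x).toLinearMap))
      0 := by
  obtain ⟨K, hK⟩ := hθ.lipschitzWith_of_hasCompactSupport hθc one_ne_zero
  have hV := (hasDerivAt_measure_image_flow volume hK hT0 hTflow hT2 hΩb hΩm).sub_const C₁
  have hid : T 0 '' Ω = Ω := by simp [hT0]
  convert! (hV.const_mul l).add ((hV.pow 2).const_mul (β / 2)) using 1
  rw [hid]
  push_cast
  ring
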